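/- arXiv:1304.2809 — 2 statements merged into one kernel-verified Lean document; each statement's English description precedes it below -/
import Mathlib

section
/- For every δ with 0 < δ < √2 − 1 there exist constants c, d > 0, depending only on δ, with the following property: for every matrix A ∈ ℝ^{k×N} whose RIP constant of order 2s is at most δ, every x̄ ∈ ℝ^N, every η ≥ 0, and every y ∈ ℝ^k with ‖Ax̄ − y‖₂ ≤ η, any minimizer x^# of ‖x‖₁ over {x ∈ ℝ^N : ‖Ax − y‖₂ ≤ η} satisfies ‖x^# − x̄‖₂ ≤ cη + d·σ_s(x̄)₁/√s. -/
open scoped BigOperators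

/-- The ℓ¹ norm of a finitely-indexed real vector. -/
noncomputable def l1norm {ι : Type*} [Fintype ι] (x : ι → ℝ) : ℝ := ∑ i, |x i|

/-- The Euclidean (ℓ²) norm of a finitely-indexed real vector. -/
noncomputable def l2norm {ι : Type*} [Fintype ι] (x : ι → ℝ) : ℝ :=
  Real.sqrt (∑ i, (x i) ^ 2)

/-- The squared Euclidean norm of a finitely-indexed real vector. -/
noncomputable def l2sq {ι : Type*} [Fintype ι] (x : ι → ℝ) : ℝ := ∑ i, (x i) ^ 2

/-- `x` is `s`-sparse: at most `s` of its components are nonzero. -/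
def IsSparse {ι : Type*} (s : ℕ) (x : ι → ℝ) : Prop :=
  ∃ S : Finset ι, S.card ≤ s ∧ ∀ i ∉ S, x i = 0

/-- The restriction `x_S` of a vector `x` to an index set `S` (zero outside `S`). -/
def restrictVec {ι : Type*} [DecidableEq ι] (S : Finset ι) (x : ι → ℝ) : ι → ℝ :=
  fun i => if i ∈ S then x i else 0

/-- `A` satisfies the Null Space Property of order `s`. -/
def NSP {κ ι : Type*} [Fintype κ] [Fintype ι] [DecidableEq ι]
    (A : Matrix κ ι ℝ) (s : ℕ) : Prop :=
  ∀ v : ι → ℝ, A.mulVec v = 0 → v ≠ 0 →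
    ∀ S : Finset ι, S.card = s → l1norm (restrictVec S v) < (1 / 2) * l1norm v

/-- `A` satisfies the Restricted Isometry Property of order `s` with constant `δ`. -/
def RIPwith {κ ι : Type*} [Fintype κ] [Fintype ι] (A : Matrix κ ι ℝ) (s : ℕ) (δ : ℝ) : Prop :=
  ∀ x : ι → ℝ, IsSparse s x →
    (1 - δ) * l2sq x ≤ l2sq (A.mulVec x) ∧ l2sq (A.mulVec x) ≤ (1 + δ) * l2sq x

/-- `A = (A1, A2)` satisfies the Null Space Property of order `t` for partially
sparse recovery (the part with matrix `A1` is the sparse part). -/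
def PartialNSP {k m r : ℕ} (A1 : Matrix (Fin k) (Fin m) ℝ) (A2 : Matrix (Fin k) (Fin r) ℝ)
    (t : ℕ) : Prop :=
  (∀ x2 : Fin r → ℝ, A2.mulVec x2 = 0 → x2 = 0) ∧
  ∀ v1 : Fin m → ℝ, v1 ≠ 0 → (∃ v2 : Fin r → ℝ, A1.mulVec v1 = A2.mulVec v2) →
    ∀ S : Finset (Fin m), S.card = t →
      l1norm (restrictVec S v1) < (1 / 2) * l1norm v1

/-- `P = I - A2 (A2ᵀ A2)⁻¹ A2ᵀ`, the orthogonal projection onto the orthogonal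
complement of the column space of `A2` (when `A2` has full column rank). -/
noncomputable def projPerp {k r : ℕ} (A2 : Matrix (Fin k) (Fin r) ℝ) :
    Matrix (Fin k) (Fin k) ℝ :=
  1 - A2 * (A2.transpose * A2)⁻¹ * A2.transpose

/-- `σ_s(x)₁`, the best `s`-term approximation error of `x` in the ℓ¹ norm. -/
noncomputable def sigma1 {ι : Type*} [Fintype ι] (s : ℕ) (x : ι → ℝ) : ℝ :=
  sInf {t | ∃ z : ι → ℝ, IsSparse s z ∧ t = l1norm (z - x)}

/-- The operator norm of a matrix induced by the Euclidean vector norms. -/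
noncomputable def opNorm2 {a b : ℕ} (M : Matrix (Fin a) (Fin b) ℝ) : ℝ :=
  sSup {t | ∃ x : Fin b → ℝ, l2norm x ≤ 1 ∧ t = l2norm (M.mulVec x)}

theorem l2norm_eq_norm_toLp {ι : Type*} [Fintype ι] (x : ι → ℝ) :
    l2norm x = ‖WithLp.toLp 2 x‖ := by
  simp [l2norm, EuclideanSpace.norm_eq]

theorem l2norm_nonneg {ι : Type*} [Fintype ι] (x : ι → ℝ) : 0 ≤ l2norm x :=
  Real.sqrt_nonneg _

theorem l2norm_sq {ι : Type*} [Fintype ι] (x : ι → ℝ) : l2norm x ^ 2 = l2sq x :=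
  Real.sq_sqrt (Finset.sum_nonneg fun _ _ => sq_nonneg _)

theorem l2norm_add_le {ι : Type*} [Fintype ι] (x y : ι → ℝ) :
    l2norm (x + y) ≤ l2norm x + l2norm y := by
  simp only [l2norm_eq_norm_toLp, WithLp.toLp_add]
  exact norm_add_le _ _

theorem l2norm_sub_le {ι : Type*} [Fintype ι] (x y : ι → ℝ) :
    l2norm (x - y) ≤ l2norm x + l2norm y := by
  simp only [l2norm_eq_norm_toLp, WithLp.toLp_sub]
  exact norm_sub_le _ _

theorem l2sq_eq_dotProduct {ι : Type*} [Fintype ι] (x : ι → ℝ) : l2sq x = x ⬝ᵥ x := by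
  simp [l2sq, dotProduct, sq]

theorem l2sq_nonneg {ι : Type*} [Fintype ι] (x : ι → ℝ) : 0 ≤ l2sq x :=
  Finset.sum_nonneg fun _ _ => sq_nonneg _

theorem dotProduct_le_l2norm_mul {ι : Type*} [Fintype ι] (x y : ι → ℝ) :
    x ⬝ᵥ y ≤ l2norm x * l2norm y :=
  Real.sum_mul_le_sqrt_mul_sqrt _ _ _

theorem l2sq_restrictVec {ι : Type*} [Fintype ι] [DecidableEq ι] (S : Finset ι) (x : ι → ℝ) :
    l2sq (restrictVec S x) = ∑ i ∈ S, x i ^ 2 := by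
  simp [l2sq, restrictVec, ite_pow]

theorem restrictVec_union {ι : Type*} [DecidableEq ι] {S T : Finset ι} (h : Disjoint S T)
    (x : ι → ℝ) : restrictVec (S ∪ T) x = restrictVec S x + restrictVec T x := by
  ext i
  have : i ∈ S → i ∉ T := fun hi => Finset.disjoint_left.1 h hi
  by_cases hS : i ∈ S <;> by_cases hT : i ∈ T <;> simp_all [restrictVec]

theorem isSparse_restrictVec {ι : Type*} [DecidableEq ι] {S : Finset ι} {s : ℕ}
    (h : S.card ≤ s) (x : ι → ℝ) : IsSparse s (restrictVec S x) :=
  ⟨S, h, fun i hi => by simp [restrictVec, hi]⟩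

/-- Under the restricted isometry property, vectors with disjoint small supports have almost
orthogonal images. -/
theorem RIPwith.abs_dotProduct_mulVec_le {κ ι : Type*} [Fintype κ] [Fintype ι] [DecidableEq ι]
    {A : Matrix κ ι ℝ} {s : ℕ} {δ : ℝ} (hδ : 0 ≤ δ) (hA : RIPwith A (2 * s) δ)
    {S T : Finset ι} (hS : S.card ≤ s) (hT : T.card ≤ s) (hST : Disjoint S T) (x : ι → ℝ) :
    |A.mulVec (restrictVec S x) ⬝ᵥ A.mulVec (restrictVec T x)| ≤
      δ * l2norm (restrictVec S x) * l2norm (restrictVec T x) := by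
  set u := restrictVec S x with hu
  set v := restrictVec T x with hv
  have huv : u ⬝ᵥ v = 0 := by
    refine Finset.sum_eq_zero fun i _ => ?_
    have : i ∈ S → i ∉ T := fun hi => Finset.disjoint_left.1 hST hi
    by_cases hS : i ∈ S <;> by_cases hT : i ∈ T <;> simp_all [restrictVec]
  have hsp (t : ℝ) : IsSparse (2 * s) (u + t • v) := by
    refine ⟨S ∪ T, (Finset.card_union_le _ _).trans (by omega), fun i hi => ?_⟩
    simp only [Finset.mem_union, not_or] at hi
    simp [hu, hv, restrictVec, hi]
  have hsq (t : ℝ) : l2sq (u + t • v) = l2sq u + t ^ 2 * l2sq v := by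
    simp only [l2sq_eq_dotProduct, add_dotProduct, dotProduct_add, smul_dotProduct,
      dotProduct_smul, smul_eq_mul, dotProduct_comm v u, huv]
    ring
  have hAsq (t : ℝ) : l2sq (A.mulVec (u + t • v)) = l2sq (A.mulVec u)
      + 2 * t * (A.mulVec u ⬝ᵥ A.mulVec v) + t ^ 2 * l2sq (A.mulVec v) := by
    simp only [Matrix.mulVec_add, Matrix.mulVec_smul, l2sq_eq_dotProduct, add_dotProduct,
      dotProduct_add, smul_dotProduct, dotProduct_smul, smul_eq_mul,
      dotProduct_comm (A.mulVec v) (A.mulVec u)]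
    ring
  set p := A.mulVec u ⬝ᵥ A.mulVec v
  have hd : discrim (δ * l2sq v) (-2 * p) (δ * l2sq u) ≤ 0 := by
    refine discrim_le_zero fun t => ?_
    have h1 := (hA _ (hsp t)).2
    have h2 := (hA _ (hsp (-t))).1
    rw [hsq, hAsq] at h1 h2
    linarith
  refine abs_le_of_sq_le_sq ?_ (by have := l2norm_nonneg u; have := l2norm_nonneg v; positivity)
  rw [mul_pow, mul_pow, l2norm_sq, l2norm_sq]
  rw [discrim] at hd
  linarith

theorem Finset.exists_subset_card_eq_forall_le {ι : Type*} [DecidableEq ι] (f : ι → ℝ)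
    (U : Finset ι) (s : ℕ) (hs : s ≤ U.card) :
    ∃ T ⊆ U, T.card = s ∧ ∀ i ∈ T, ∀ j ∈ U \ T, f j ≤ f i := by
  induction s with
  | zero => exact ⟨∅, by simp⟩
  | succ s ih =>
    obtain ⟨T, hTU, hT, hle⟩ := ih (by omega)
    have hne : (U \ T).Nonempty := by
      rw [← Finset.card_pos, Finset.card_sdiff_of_subset hTU]
      omega
    obtain ⟨m, hm, hmax⟩ := Finset.exists_max_image (U \ T) f hne
    have hm' := Finset.mem_sdiff.1 hm
    refine ⟨insert m T, Finset.insert_subset hm'.1 hTU, by simp [hm'.2, hT], ?_⟩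
    intro i hi j hj
    have hj' : j ∈ U \ T := by
      simp only [Finset.mem_sdiff, Finset.mem_insert, not_or] at hj ⊢
      tauto
    rcases Finset.mem_insert.1 hi with rfl | hi
    · exact hmax j hj'
    · exact hle i hi j hj'

theorem l2norm_restrictVec_le_of_dominated {ι : Type*} [Fintype ι] [DecidableEq ι]
    {x : ι → ℝ} {S T : Finset ι} {s : ℕ} (hs : 0 < s) (hS : S.card = s) (hT : T.card ≤ s)
    (hle : ∀ i ∈ S, ∀ j ∈ T, |x j| ≤ |x i|) :
    l2norm (restrictVec T x) ≤ (∑ i ∈ S, |x i|) / Real.sqrt s := by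
  have hs' : (0 : ℝ) < s := by exact_mod_cast hs
  have hsum : 0 ≤ ∑ i ∈ S, |x i| := Finset.sum_nonneg fun _ _ => abs_nonneg _
  have hj (j : ι) (hj : j ∈ T) : |x j| ≤ (∑ i ∈ S, |x i|) / s := by
    rw [le_div_iff₀ hs', mul_comm]
    simpa [hS] using Finset.card_nsmul_le_sum S (fun i => |x i|) |x j| fun i hi => hle i hi j hj
  refine abs_le_of_sq_le_sq' ?_ (by positivity) |>.2
  rw [l2norm_sq, l2sq_restrictVec, div_pow, Real.sq_sqrt hs'.le]
  calc ∑ i ∈ T, x i ^ 2 ≤ T.card • ((∑ i ∈ S, |x i|) / s) ^ 2 :=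
        Finset.sum_le_card_nsmul _ _ _ fun i hi => by
          rw [← sq_abs]; exact pow_le_pow_left₀ (abs_nonneg _) (hj i hi) 2
    _ ≤ s * ((∑ i ∈ S, |x i|) / s) ^ 2 := by
        rw [nsmul_eq_mul]; gcongr
    _ = (∑ i ∈ S, |x i|) ^ 2 / s := by field_simp

/-- Splitting `U` into blocks of size `s` by decreasing magnitude: with `T` the leading block, a
subadditive functional controlled by the Euclidean norm on small blocks is controlled on `U \ T`
by the `ℓ¹` norm on `U`. -/
theorem exists_leading_block {ι : Type*} [Fintype ι] [DecidableEq ι] {s : ℕ} (hs : 0 < s)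
    (x : ι → ℝ) (U : Finset ι) :
    ∃ T ⊆ U, T.card ≤ s ∧ ∀ (F : (ι → ℝ) → ℝ) (C : ℝ), 0 ≤ C →
      (∀ v w, F (v + w) ≤ F v + F w) →
      (∀ W ⊆ U \ T, W.card ≤ s → F (restrictVec W x) ≤ C * l2norm (restrictVec W x)) →
      F (restrictVec (U \ T) x) ≤ C * ((∑ i ∈ U, |x i|) / Real.sqrt s) := by
  induction U using Finset.strongInduction with
  | H U ih =>
    rcases le_or_gt U.card s with hU | hU
    · refine ⟨U, subset_rfl, hU, fun F C hC _ hF => (hF _ subset_rfl (by simp)).trans ?_⟩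
      have hsum : 0 ≤ ∑ i ∈ U, |x i| := Finset.sum_nonneg fun _ _ => abs_nonneg _
      have h0 : l2norm (restrictVec (U \ U) x) = 0 := by simp [l2norm, restrictVec]
      rw [h0, mul_zero]
      positivity
    · obtain ⟨T, hTU, hT, hle⟩ :=
        Finset.exists_subset_card_eq_forall_le (fun i => |x i|) U s hU.le
      obtain ⟨T', hT'U, hT', hF'⟩ := ih (U \ T) (Finset.sdiff_ssubset hTU
        (Finset.card_pos.1 (by omega)))
      refine ⟨T, hTU, hT.le, fun F C hC hadd hF => ?_⟩
      have h1 := hF' F C hC hadd fun W hW => hF W (hW.trans Finset.sdiff_subset)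
      have h2 := hF T' hT'U hT'
      have h3 := l2norm_restrictVec_le_of_dominated (x := x) hs hT hT'
        fun i hi j hj => hle i hi j (hT'U hj)
      have h4 := hadd (restrictVec T' x) (restrictVec ((U \ T) \ T') x)
      rw [← restrictVec_union Finset.disjoint_sdiff, Finset.union_sdiff_of_subset hT'U] at h4
      have h5 := mul_le_mul_of_nonneg_left h3 hC
      rw [← Finset.sum_sdiff hTU, add_div, mul_add]
      linarith

theorem sum_abs_div_sqrt_le_l2norm {ι : Type*} [Fintype ι] [DecidableEq ι] {s : ℕ} (hs : 0 < s)
    {S : Finset ι} (hS : S.card ≤ s) (x : ι → ℝ) :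
    (∑ i ∈ S, |x i|) / Real.sqrt s ≤ l2norm (restrictVec S x) := by
  have hs' : (0 : ℝ) < s := by exact_mod_cast hs
  refine abs_le_of_sq_le_sq' ?_ (l2norm_nonneg _) |>.2
  rw [l2norm_sq, l2sq_restrictVec, div_pow, Real.sq_sqrt hs'.le, div_le_iff₀ hs']
  calc (∑ i ∈ S, |x i|) ^ 2 ≤ S.card * ∑ i ∈ S, |x i| ^ 2 := sq_sum_le_card_mul_sum_sq
    _ ≤ s * ∑ i ∈ S, |x i| ^ 2 := by
        gcongr
    _ = (∑ i ∈ S, x i ^ 2) * s := by simp [mul_comm]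

/-- The cone condition satisfied by the error of a vector of smaller `ℓ¹` norm. -/
theorem sum_compl_abs_sub_le {ι : Type*} [Fintype ι] [DecidableEq ι] {x y : ι → ℝ}
    (h : l1norm x ≤ l1norm y) (S : Finset ι) :
    ∑ i ∈ Sᶜ, |(x - y) i| ≤ ∑ i ∈ S, |(x - y) i| + 2 * ∑ i ∈ Sᶜ, |y i| := by
  rw [l1norm, l1norm, ← Finset.sum_add_sum_compl S, ← Finset.sum_add_sum_compl S] at h
  have h1 : ∑ i ∈ S, |y i| ≤ ∑ i ∈ S, |x i| + ∑ i ∈ S, |(x - y) i| := by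
    rw [← Finset.sum_add_distrib]
    refine Finset.sum_le_sum fun i _ => ?_
    have := abs_sub_abs_le_abs_sub (y i) (x i)
    rw [abs_sub_comm] at this
    simp only [Pi.sub_apply]
    linarith
  have h2 : ∑ i ∈ Sᶜ, |(x - y) i| ≤ ∑ i ∈ Sᶜ, |x i| + ∑ i ∈ Sᶜ, |y i| := by
    rw [← Finset.sum_add_distrib]
    exact Finset.sum_le_sum fun i _ => abs_sub _ _
  linarith

theorem sum_compl_abs_le_l1norm_sub {ι : Type*} [Fintype ι] [DecidableEq ι] {S : Finset ι}
    {z : ι → ℝ} (hz : ∀ i ∉ S, z i = 0) (x : ι → ℝ) :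
    ∑ i ∈ Sᶜ, |x i| ≤ l1norm (z - x) :=
  calc ∑ i ∈ Sᶜ, |x i| = ∑ i ∈ Sᶜ, |(z - x) i| :=
        Finset.sum_congr rfl fun i hi => by simp [hz i (Finset.mem_compl.1 hi)]
    _ ≤ l1norm (z - x) :=
        Finset.sum_le_sum_of_subset_of_nonneg (Finset.subset_univ _) fun _ _ _ => abs_nonneg _

/-- Under the restricted isometry property, a vector is controlled by its image and by its `ℓ¹`
norm outside a small set `S`, through its part on a set `S ∪ T`. -/
theorem RIPwith.exists_l2norm_le {κ ι : Type*} [Fintype κ] [Fintype ι] [DecidableEq ι]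
    {A : Matrix κ ι ℝ} {s : ℕ} {δ : ℝ} (hs : 0 < s) (hδ : 0 ≤ δ) (hA : RIPwith A (2 * s) δ)
    {S : Finset ι} (hS : S.card ≤ s) (h : ι → ℝ) :
    ∃ m, l2norm (restrictVec S h) ≤ m ∧
      l2norm h ≤ m + (∑ i ∈ Sᶜ, |h i|) / Real.sqrt s ∧
      (1 - δ) * m ≤ Real.sqrt (1 + δ) * l2norm (A.mulVec h)
        + Real.sqrt 2 * δ * ((∑ i ∈ Sᶜ, |h i|) / Real.sqrt s) := by
  obtain ⟨T, hTS, hT, hF⟩ := exists_leading_block hs h Sᶜ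
  have hdST : Disjoint S T := (Finset.subset_compl_iff_disjoint_left).1 hTS
  set R := Sᶜ \ T with hR
  set Q := (∑ i ∈ Sᶜ, |h i|) / Real.sqrt s with hQ
  have hQ0 : 0 ≤ Q := div_nonneg (Finset.sum_nonneg fun _ _ => abs_nonneg _) (Real.sqrt_nonneg _)
  have hdR : Disjoint (S ∪ T) R := by
    rw [Finset.disjoint_left]
    intro i hi
    simp only [hR, Finset.mem_union, Finset.mem_sdiff, Finset.mem_compl] at hi ⊢
    tauto
  have hsplit : h = restrictVec (S ∪ T) h + restrictVec R h := by
    rw [← restrictVec_union hdR]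
    ext i
    have : i ∈ S ∪ T ∪ R := by
      simp only [hR, Finset.mem_union, Finset.mem_sdiff, Finset.mem_compl]
      tauto
    exact (if_pos this).symm
  have hST := restrictVec_union hdST h
  have hr : l2norm (restrictVec R h) ≤ Q := by
    simpa using hF l2norm 1 zero_le_one l2norm_add_le fun W _ _ => by simp
  have hcross (V : Finset ι) (hV : V.card ≤ s) (hVR : Disjoint V R) :
      |A.mulVec (restrictVec V h) ⬝ᵥ A.mulVec (restrictVec R h)| ≤
        δ * l2norm (restrictVec V h) * Q := by
    refine hF (fun w => |A.mulVec (restrictVec V h) ⬝ᵥ A.mulVec w|) _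
      (mul_nonneg hδ (l2norm_nonneg _)) (fun v w => ?_) fun W hW hWs => ?_
    · simp only [Matrix.mulVec_add, dotProduct_add]
      exact abs_add_le _ _
    · exact hA.abs_dotProduct_mulVec_le hδ hV hWs (hVR.mono_right hW) h
  have hS' := neg_le_of_abs_le (hcross S hS (hdR.mono_left Finset.subset_union_left))
  have hT' := neg_le_of_abs_le (hcross T hT (hdR.mono_left Finset.subset_union_right))
  have hrip := hA (restrictVec (S ∪ T) h)
    (isSparse_restrictVec ((Finset.card_union_le _ _).trans (by omega)) h)
  have hpyth : l2norm (restrictVec (S ∪ T) h) ^ 2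
      = l2norm (restrictVec S h) ^ 2 + l2norm (restrictVec T h) ^ 2 := by
    simp only [l2norm_sq, l2sq_restrictVec, Finset.sum_union hdST]
  have hAh : l2sq (A.mulVec (restrictVec (S ∪ T) h)) =
      A.mulVec (restrictVec (S ∪ T) h) ⬝ᵥ A.mulVec h
        - A.mulVec (restrictVec S h) ⬝ᵥ A.mulVec (restrictVec R h)
        - A.mulVec (restrictVec T h) ⬝ᵥ A.mulVec (restrictVec R h) := by
    have h1 : A.mulVec h = A.mulVec (restrictVec (S ∪ T) h) + A.mulVec (restrictVec R h) := by
      rw [← Matrix.mulVec_add, ← hsplit]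
    rw [l2sq_eq_dotProduct, h1, dotProduct_add, hST, Matrix.mulVec_add,
      add_dotProduct _ _ (A.mulVec (restrictVec R h))]
    ring
  have hcs := dotProduct_le_l2norm_mul (A.mulVec (restrictVec (S ∪ T) h)) (A.mulVec h)
  have htri := l2norm_add_le (restrictVec (S ∪ T) h) (restrictVec R h)
  rw [← hsplit] at htri
  rw [← l2norm_sq, ← l2norm_sq] at hrip
  rw [← l2norm_sq] at hAh
  have ha := l2norm_nonneg (restrictVec S h)
  have hb := l2norm_nonneg (restrictVec T h)
  have hm := l2norm_nonneg (restrictVec (S ∪ T) h)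
  have hn := l2norm_nonneg (A.mulVec h)
  have hg := l2norm_nonneg (A.mulVec (restrictVec (S ∪ T) h))
  generalize l2norm (restrictVec S h) = a at *
  generalize l2norm (restrictVec T h) = b at *
  generalize l2norm (A.mulVec h) = n at *
  generalize l2norm (A.mulVec (restrictVec (S ∪ T) h)) = g at *
  generalize l2norm (restrictVec (S ∪ T) h) = m at *
  have ham : a ≤ m := abs_le_of_sq_le_sq' (by nlinarith [sq_nonneg b]) hm |>.2
  refine ⟨m, ham, by linarith, ?_⟩
  have habm : a + b ≤ Real.sqrt 2 * m := by
    refine abs_le_of_sq_le_sq' ?_ (by positivity) |>.2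
    rw [mul_pow, Real.sq_sqrt zero_le_two]
    nlinarith [sq_nonneg (a - b)]
  have hgm : g ≤ Real.sqrt (1 + δ) * m := by
    refine abs_le_of_sq_le_sq' ?_ (by positivity) |>.2
    rw [mul_pow, Real.sq_sqrt (by linarith)]
    exact hrip.2
  rcases hm.eq_or_lt with hm0 | hm0
  · rw [← hm0, mul_zero]
    positivity
  refine le_of_mul_le_mul_right ?_ hm0
  have h1 : g * n ≤ Real.sqrt (1 + δ) * m * n := mul_le_mul_of_nonneg_right hgm hn
  have h2 : δ * Q * (a + b) ≤ δ * Q * (Real.sqrt 2 * m) :=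
    mul_le_mul_of_nonneg_left habm (by positivity)
  linarith [hrip.1]

theorem le_add_mul_sigma1_div {ι : Type*} [Fintype ι] {s : ℕ} (hs : 0 < s) {x : ι → ℝ}
    {b c d : ℝ} (hd : 0 < d)
    (h : ∀ z, IsSparse s z → b ≤ c + d * l1norm (z - x) / Real.sqrt s) :
    b ≤ c + d * sigma1 s x / Real.sqrt s := by
  have hs' : 0 < Real.sqrt s := Real.sqrt_pos.2 (by exact_mod_cast hs)
  have key : (b - c) * Real.sqrt s / d ≤ sigma1 s x := by
    refine le_csInf ⟨_, 0, ⟨∅, by simp⟩, rfl⟩ ?_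
    rintro _ ⟨z, hz, rfl⟩
    rw [div_le_iff₀ hd, ← le_div_iff₀ hs', mul_comm _ d]
    linarith [h z hz]
  rw [div_le_iff₀ hd, ← le_div_iff₀ hs', mul_comm _ d] at key
  linarith

/-- For every `0 < δ < √2 - 1` there are constants `c, d > 0`, depending
only on `δ`, such that for every matrix `A` whose RIP constant of order `2s` is at most `δ`
(i.e. `A` satisfies the RIP of order `2s` with constant `δ`), every `x̄`, every `η ≥ 0` and
every `y` with `‖Ax̄ - y‖₂ ≤ η`, any minimizer `x⁰` of `‖x‖₁` over `{x : ‖Ax - y‖₂ ≤ η}`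
satisfies `‖x⁰ - x̄‖₂ ≤ cη + d σ_s(x̄)₁ / √s`. -/
theorem noisy_recovery_error_bound :
    ∀ δ : ℝ, 0 < δ → δ < Real.sqrt 2 - 1 →
      ∃ c d : ℝ, 0 < c ∧ 0 < d ∧
        ∀ (k N s : ℕ), 0 < s → ∀ A : Matrix (Fin k) (Fin N) ℝ,
          RIPwith A (2 * s) δ →
            ∀ (xbar : Fin N → ℝ) (η : ℝ), 0 ≤ η → ∀ y : Fin k → ℝ,
              l2norm (A.mulVec xbar - y) ≤ η →
                ∀ xsharp : Fin N → ℝ,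
                  l2norm (A.mulVec xsharp - y) ≤ η →
                  (∀ x : Fin N → ℝ, l2norm (A.mulVec x - y) ≤ η → l1norm xsharp ≤ l1norm x) →
                  l2norm (xsharp - xbar) ≤ c * η + d * sigma1 s xbar / Real.sqrt s := by
  intro δ hδ hδ'
  have h2 : Real.sqrt 2 ^ 2 = 2 := Real.sq_sqrt zero_le_two
  have h2n := Real.sqrt_nonneg 2
  have hδ1 : 0 < 1 - δ := by nlinarith
  have hgap : 0 < 1 - δ - Real.sqrt 2 * δ := by nlinarith
  set κ := 1 - δ - Real.sqrt 2 * δ with hκ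
  refine ⟨4 * Real.sqrt (1 + δ) / κ, 4 * Real.sqrt 2 * δ / κ + 2, by positivity, by positivity, ?_⟩
  intro k N s hs A hA xbar η hη y hy xsharp hx hmin
  refine le_add_mul_sigma1_div hs (by positivity) ?_
  rintro z ⟨S, hS, hz⟩
  obtain ⟨m, ham, hhm, hm⟩ := hA.exists_l2norm_le hs hδ.le hS (xsharp - xbar)
  have hAh : l2norm (A.mulVec (xsharp - xbar)) ≤ 2 * η := by
    have := l2norm_sub_le (A.mulVec xsharp - y) (A.mulVec xbar - y)
    rw [sub_sub_sub_cancel_right, ← Matrix.mulVec_sub] at this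
    linarith
  have hcone := sum_compl_abs_sub_le (hmin xbar hy) S
  have htail := sum_compl_abs_le_l1norm_sub hz xbar
  have hhead := sum_abs_div_sqrt_le_l2norm hs hS (xsharp - xbar)
  set e := l1norm (z - xbar) / Real.sqrt s with he
  set Q := (∑ i ∈ Sᶜ, |(xsharp - xbar) i|) / Real.sqrt s with hQ
  have hQe : Q ≤ m + 2 * e := by
    have : Q ≤ (∑ i ∈ S, |(xsharp - xbar) i| + 2 * l1norm (z - xbar)) / Real.sqrt s := by
      rw [hQ]
      gcongr
      linarith
    rw [add_div, mul_div_assoc] at this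
    linarith
  have hmκ : m ≤ (2 * Real.sqrt (1 + δ) * η + 2 * Real.sqrt 2 * δ * e) / κ := by
    rw [le_div_iff₀ hgap]
    have h3 := mul_le_mul_of_nonneg_left hAh (Real.sqrt_nonneg (1 + δ))
    have h4 := mul_le_mul_of_nonneg_left hQe (by positivity : 0 ≤ Real.sqrt 2 * δ)
    rw [hκ]
    linarith
  calc l2norm (xsharp - xbar)
      ≤ 2 * ((2 * Real.sqrt (1 + δ) * η + 2 * Real.sqrt 2 * δ * e) / κ) + 2 * e := by linarith
    _ = _ := by rw [mul_div_assoc _ (l1norm (z - xbar)), ← he]; ring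
end

section
/- Let A1 ∈ ℝ^{k×(N−r)}, A2 ∈ ℝ^{k×r} with A2 of full column rank, P = I − A2(A2ᵀA2)⁻¹A2ᵀ, y ∈ ℝ^k, and η ≥ 0. If (x1*, x2*) is a minimizer of ‖x1‖₁ over {(x1, x2) : ‖A1x1 + A2x2 − y‖₂ ≤ η}, then x1* is a minimizer of ‖x1‖₁ over {x1 ∈ ℝ^{N−r} : ‖P A1 x1 − P y‖₂ ≤ η}. -/
open scoped BigOperators

section Projection

variable {k r : ℕ} {A : Matrix (Fin k) (Fin r) ℝ}

theorem l2norm_eq_sqrt_dotProduct {ι : Type*} [Fintype ι] (x : ι → ℝ) :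
    l2norm x = Real.sqrt (x ⬝ᵥ x) := by
  simp only [l2norm, dotProduct, sq]

theorem isUnit_det_transpose_mul_self (hA : ∀ x : Fin r → ℝ, A.mulVec x = 0 → x = 0) :
    IsUnit (A.transpose * A).det := by
  rw [← Matrix.isUnit_iff_isUnit_det, ← Matrix.mulVec_injective_iff_isUnit,
    ← Matrix.coe_mulVecLin, ← LinearMap.ker_eq_bot, Matrix.ker_mulVecLin_transpose_mul_self,
    LinearMap.ker_eq_bot']
  exact hA

theorem projPerp_mulVec (A : Matrix (Fin k) (Fin r) ℝ) (v : Fin k → ℝ) :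
    (projPerp A).mulVec v =
      v - A.mulVec (((A.transpose * A)⁻¹ * A.transpose).mulVec v) := by
  rw [projPerp, Matrix.sub_mulVec, Matrix.one_mulVec, Matrix.mul_assoc, Matrix.mulVec_mulVec]

theorem projPerp_mul_self (hA : ∀ x : Fin r → ℝ, A.mulVec x = 0 → x = 0) :
    projPerp A * A = 0 := by
  rw [projPerp, Matrix.sub_mul, Matrix.one_mul, Matrix.mul_assoc, Matrix.mul_assoc,
    Matrix.nonsing_inv_mul _ (isUnit_det_transpose_mul_self hA), Matrix.mul_one, sub_self]

theorem transpose_mul_projPerp (hA : ∀ x : Fin r → ℝ, A.mulVec x = 0 → x = 0) :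
    A.transpose * projPerp A = 0 := by
  rw [projPerp, Matrix.mul_sub, Matrix.mul_one, ← Matrix.mul_assoc, ← Matrix.mul_assoc,
    Matrix.mul_nonsing_inv _ (isUnit_det_transpose_mul_self hA), Matrix.one_mul, sub_self]

theorem l2norm_projPerp_mulVec_le (hA : ∀ x : Fin r → ℝ, A.mulVec x = 0 → x = 0)
    (v : Fin k → ℝ) : l2norm ((projPerp A).mulVec v) ≤ l2norm v := by
  rw [l2norm_eq_sqrt_dotProduct, l2norm_eq_sqrt_dotProduct]
  apply Real.sqrt_le_sqrt
  set p := (projPerp A).mulVec v with hp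
  set w := ((A.transpose * A)⁻¹ * A.transpose).mulVec v
  have hv : v = p + A.mulVec w := by rw [hp, projPerp_mulVec, sub_add_cancel]
  have horth : p ⬝ᵥ A.mulVec w = 0 := by
    rw [Matrix.dotProduct_mulVec, ← Matrix.mulVec_transpose, hp, Matrix.mulVec_mulVec,
      transpose_mul_projPerp hA, Matrix.zero_mulVec, zero_dotProduct]
  have hnonneg : 0 ≤ A.mulVec w ⬝ᵥ A.mulVec w :=
    Finset.sum_nonneg fun i _ => mul_self_nonneg _
  calc p ⬝ᵥ p ≤ p ⬝ᵥ p + A.mulVec w ⬝ᵥ A.mulVec w := le_add_of_nonneg_right hnonneg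
    _ = (p + A.mulVec w) ⬝ᵥ (p + A.mulVec w) := by
      rw [add_dotProduct, dotProduct_add, dotProduct_add, dotProduct_comm (A.mulVec w) p, horth]
      ring
    _ = v ⬝ᵥ v := by rw [← hv]

end Projection

/-- If `(x1⋆, x2⋆)` minimizes `‖x1‖₁` over
`{(x1, x2) : ‖A1x1 + A2x2 - y‖₂ ≤ η}` (with `A2` of full column rank), then `x1⋆`
minimizes `‖x1‖₁` over `{x1 : ‖P A1 x1 - P y‖₂ ≤ η}`. -/
theorem minimizer_transfer_to_projected_problem {k N r : ℕ}
    (A1 : Matrix (Fin k) (Fin (N - r)) ℝ) (A2 : Matrix (Fin k) (Fin r) ℝ)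
    (hA2 : ∀ x2 : Fin r → ℝ, A2.mulVec x2 = 0 → x2 = 0)
    (y : Fin k → ℝ) (η : ℝ) (hη : 0 ≤ η)
    (x1star : Fin (N - r) → ℝ) (x2star : Fin r → ℝ)
    (hfeas : l2norm (A1.mulVec x1star + A2.mulVec x2star - y) ≤ η)
    (hmin : ∀ (x1 : Fin (N - r) → ℝ) (x2 : Fin r → ℝ),
      l2norm (A1.mulVec x1 + A2.mulVec x2 - y) ≤ η → l1norm x1star ≤ l1norm x1) :
    l2norm ((projPerp A2).mulVec (A1.mulVec x1star) - (projPerp A2).mulVec y) ≤ η ∧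
    ∀ x1 : Fin (N - r) → ℝ,
      l2norm ((projPerp A2).mulVec (A1.mulVec x1) - (projPerp A2).mulVec y) ≤ η →
        l1norm x1star ≤ l1norm x1 := by
  constructor
  · have hproj : (projPerp A2).mulVec (A1.mulVec x1star) - (projPerp A2).mulVec y =
        (projPerp A2).mulVec (A1.mulVec x1star + A2.mulVec x2star - y) := by
      rw [Matrix.mulVec_sub, Matrix.mulVec_add, Matrix.mulVec_mulVec x2star,
        projPerp_mul_self hA2, Matrix.zero_mulVec, add_zero]
    rw [hproj]
    exact (l2norm_projPerp_mulVec_le hA2 _).trans hfeas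
  · intro x1 hx1
    refine hmin x1 (-((A2.transpose * A2)⁻¹ * A2.transpose).mulVec (A1.mulVec x1 - y)) ?_
    rwa [Matrix.mulVec_neg, ← sub_eq_add_neg, sub_right_comm, ← projPerp_mulVec,
      Matrix.mulVec_sub]
end
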